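/- Let x, y ∈ ℝⁿ, let f₁, …, f_m be real-valued functions convex on the segment [x, y], and let f := max_{i=1,…,m} f_i. Suppose there exists t₀ ∈ (0, 1) such that f(t₀x + (1−t₀)y) = t₀ f(x) + (1−t₀) f(y). Set z := t₀x + (1−t₀)y and let i be any index with f(z) = f_i(z). Then f(u) = f_i(u) for all u ∈ [x, y]. -/

import Mathlib

/-- If a convex function on `[x, y]` is at most `B` at `y` but attains the
chord value `t * A + (1 - t) * B` at `t • x + (1 - t) • y`, then it lies above the chord between
this point and `x`. -/
theorem ConvexOn.chord_le_of_chord_eq {E : Type*} [AddCommGroup E] [Module ℝ E] {x y : E}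
    {g : E → ℝ} (hg : ConvexOn ℝ (segment ℝ x y) g) {A B t s : ℝ} (hy : g y ≤ B)
    (ht : 0 < t) (hz : g (t • x + (1 - t) • y) = t * A + (1 - t) * B) (hts : t ≤ s)
    (hs : s ≤ 1) : s * A + (1 - s) * B ≤ g (s • x + (1 - s) • y) := by
  have hs0 : 0 < s := ht.trans_le hts
  have hu : s • x + (1 - s) • y ∈ segment ℝ x y :=
    ⟨s, 1 - s, hs0.le, by linarith, by ring, rfl⟩
  have ha : 0 < t / s := div_pos ht hs0
  have ha1 : 0 ≤ 1 - t / s := sub_nonneg.2 ((div_le_one hs0).2 hts)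
  have has : t / s * s = t := div_mul_cancel₀ t hs0.ne'
  have key := hg.2 hu (right_mem_segment ℝ x y) ha.le ha1 (by ring)
  have hpt : (t / s) • (s • x + (1 - s) • y) + (1 - t / s) • y = t • x + (1 - t) • y := by
    rw [smul_add, smul_smul, smul_smul, add_assoc, ← add_smul, has]
    congr 2
    linear_combination -has
  rw [hpt, hz, smul_eq_mul, smul_eq_mul] at key
  have hchord : t * A + (1 - t) * B = t / s * (s * A + (1 - s) * B) + (1 - t / s) * B := by
    linear_combination (B - A) * has
  exact le_of_mul_le_mul_left
    (by linarith [mul_le_mul_of_nonneg_left hy ha1]) ha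

/-- Let `f₁, …, f_m` be convex on the segment `[x, y]` and let
`f = maxᵢ fᵢ`.  If `f(t₀x + (1−t₀)y) = t₀ f(x) + (1−t₀) f(y)` for some `t₀ ∈ (0, 1)`,
`z = t₀x + (1−t₀)y`, and `i` is an active index at `z` (`f(z) = fᵢ(z)`), then
`f(u) = fᵢ(u)` for all `u ∈ [x, y]`. -/
theorem stmt_15 {n m : ℕ} (hm : 0 < m) (x y : EuclideanSpace ℝ (Fin n))
    (f : Fin m → EuclideanSpace ℝ (Fin n) → ℝ)
    (hf : ∀ i, ConvexOn ℝ (segment ℝ x y) (f i))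
    (F : EuclideanSpace ℝ (Fin n) → ℝ) (hF : ∀ u, F u = ⨆ i, f i u)
    (t₀ : ℝ) (ht₀ : t₀ ∈ Set.Ioo (0 : ℝ) 1)
    (heq : F (t₀ • x + (1 - t₀) • y) = t₀ * F x + (1 - t₀) * F y)
    (i : Fin m) (hi : F (t₀ • x + (1 - t₀) • y) = f i (t₀ • x + (1 - t₀) • y)) :
    ∀ u ∈ segment ℝ x y, F u = f i u := by
  have hle : ∀ j v, f j v ≤ F v := fun j v => by
    rw [hF]
    exact le_ciSup (f := fun k => f k v) (Set.finite_range _).bddAbove j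
  rintro u ⟨a, b, ha, hb, hab, rfl⟩
  obtain rfl : b = 1 - a := by linarith
  refine le_antisymm ?_ (hle i _)
  have hupper : F (a • x + (1 - a) • y) ≤ a * F x + (1 - a) * F y := by
    have : Nonempty (Fin m) := ⟨i⟩
    rw [hF (a • x + (1 - a) • y)]
    refine ciSup_le fun j => ?_
    refine ((hf j).2 (left_mem_segment ℝ x y) (right_mem_segment ℝ x y) ha hb hab).trans ?_
    exact add_le_add (mul_le_mul_of_nonneg_left (hle j x) ha)
      (mul_le_mul_of_nonneg_left (hle j y) hb)
  refine hupper.trans ?_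
  have hz := hi.symm.trans heq
  rcases le_total t₀ a with h | h
  · exact (hf i).chord_le_of_chord_eq (hle i y) ht₀.1 hz h (by linarith)
  · have hsymm : ConvexOn ℝ (segment ℝ y x) (f i) := segment_symm ℝ x y ▸ hf i
    have := hsymm.chord_le_of_chord_eq (A := F y) (B := F x) (t := 1 - t₀) (s := 1 - a)
      (hle i x) (by linarith [ht₀.2])
      (by rw [sub_sub_cancel, add_comm, hz, add_comm]) (by linarith) (by linarith)
    rwa [sub_sub_cancel, add_comm, add_comm ((1 - a) • y)] at this
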